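/- Let a, b ≥ 1 be integers and u ∈ ℤ_p^× with −u not a norm from H^× (i.e. −u ∉ Nm_{H/ℚ_p}(H^×)). Let L = O_H e_1 ⊕ O_H e_2 be the hermitian O_H-lattice with (e_1,e_1) = (−π_0)^a, (e_2,e_2) = u(−π_0)^b and (e_1,e_2) = 0. Then Λ = O_H π^{−a} e_1 ⊕ O_H π^{−b} e_2 is the unique self-dual O_H-lattice (i.e. Λ = Λ♯) in the hermitian space L ⊗_{O_H} H which contains L. -/

import Mathlib

/- Common setup: ramified quadratic extension H/ℚ_p, ring of integers O_H,
   hermitian forms, lattices, duals, vertex lattices. -/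

open scoped Classical

noncomputable section

namespace Ramified

/-- The ring of integers of `H`: the integral closure of `ℤ_p` in `H`. -/
def OH (p : ℕ) [Fact (Nat.Prime p)] (H : Type) [Field H] [Algebra ℚ_[p] H] : Subring H :=
  letI : Algebra ℤ_[p] H := ((algebraMap ℚ_[p] H).comp PadicInt.Coe.ringHom).toAlgebra
  (integralClosure ℤ_[p] H).toSubring

/-- `H/ℚ_p` is a ramified quadratic extension with nontrivial Galois automorphism `conj`
and uniformizer `ϖ` satisfying `conj ϖ = -ϖ` and `ϖ² = π₀` a uniformizer of `ℤ_p`. -/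
structure IsRamifiedQuadratic (p : ℕ) [Fact (Nat.Prime p)] (H : Type) [Field H]
    [Algebra ℚ_[p] H] (conj : H ≃+* H) (ϖ : H) : Prop where
  conj_conj : ∀ x : H, conj (conj x) = x
  conj_fix : ∀ q : ℚ_[p], conj (algebraMap ℚ_[p] H q) = algebraMap ℚ_[p] H q
  conj_ne : conj ≠ RingEquiv.refl H
  dim_two : Module.finrank ℚ_[p] H = 2
  conj_unif : conj ϖ = -ϖ
  unif_sq : ∃ u : ℤ_[p]ˣ, ϖ * ϖ = algebraMap ℚ_[p] H ((u : ℤ_[p]) : ℚ_[p]) * (p : H)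

variable {p : ℕ} [Fact (Nat.Prime p)] {H : Type} [Field H] [Algebra ℚ_[p] H]

/-- Any `H`-module is an `O_H`-module by restriction of scalars. -/
instance moduleOH (C : Type) [AddCommGroup C] [Module H C] : Module (OH p H) C :=
  Module.compHom C (OH p H).subtype

variable {C : Type} [AddCommGroup C] [Module H C]

theorem oh_smul_def (c : OH p H) (x : C) : c • x = (c : H) • x := rfl

/-- A hermitian form on `C` with respect to the conjugation `conj` of `H`:
linear in the first variable, conjugate-symmetric. -/
structure HermForm (H : Type) [Field H] (C : Type) [AddCommGroup C] [Module H C]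
    (conj : H ≃+* H) where
  form : C → C → H
  form_add : ∀ x y z : C, form (x + y) z = form x z + form y z
  form_smul : ∀ (a : H) (x y : C), form (a • x) y = a * form x y
  form_conj : ∀ x y : C, form y x = conj (form x y)

variable {conj : H ≃+* H}

theorem HermForm.form_zero (φ : HermForm H C conj) (y : C) : φ.form 0 y = 0 := by
  have h := φ.form_smul (0 : H) 0 y
  simpa using h

/-- The dual lattice `Λ♯ = {x : C | φ(x, Λ) ⊆ O_H}`. -/
def HermForm.dual (φ : HermForm H C conj) (Λ : Submodule (OH p H) C) :
    Submodule (OH p H) C where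
  carrier := {x : C | ∀ y ∈ Λ, φ.form x y ∈ OH p H}
  add_mem' := by
    intro a b ha hb y hy
    rw [φ.form_add]
    exact add_mem (ha y hy) (hb y hy)
  zero_mem' := by
    intro y hy
    rw [HermForm.form_zero]
    exact zero_mem _
  smul_mem' := by
    intro c x hx y hy
    show φ.form ((c : H) • x) y ∈ OH p H
    rw [φ.form_smul]
    exact mul_mem c.2 (hx y hy)

/-- The orthogonal complement (in `C = L ⊗ H`) of a sublattice. -/
def HermForm.orthog (φ : HermForm H C conj) (N : Submodule (OH p H) C) :
    Submodule (OH p H) C where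
  carrier := {x : C | ∀ y ∈ N, φ.form x y = 0}
  add_mem' := by
    intro a b ha hb y hy
    rw [φ.form_add, ha y hy, hb y hy, add_zero]
  zero_mem' := by
    intro y hy
    rw [HermForm.form_zero]
  smul_mem' := by
    intro c x hx y hy
    show φ.form ((c : H) • x) y = 0
    rw [φ.form_smul, hx y hy, mul_zero]

/-- Scalar multiplication by `a : H`, as an `O_H`-linear map. -/
def smulMap (a : H) : C →ₗ[OH p H] C where
  toFun x := a • x
  map_add' x y := smul_add a x y
  map_smul' c x := by
    show a • ((c : H) • x) = (c : H) • (a • x)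
    rw [smul_comm]

/-- The lattice `a • Λ` for a scalar `a : H`. -/
def scale (a : H) (Λ : Submodule (OH p H) C) : Submodule (OH p H) C :=
  Λ.map (smulMap a)

/-- An `H`-subspace of `C`, viewed as an `O_H`-submodule. -/
def restrictOH (W : Submodule H C) : Submodule (OH p H) C where
  carrier := (W : Set C)
  add_mem' := fun ha hb => W.add_mem ha hb
  zero_mem' := W.zero_mem
  smul_mem' := fun c x hx => W.smul_mem (c : H) hx

/-- The cardinality of the quotient `Λ/N` (for `N ⊆ Λ` this is the usual quotient). -/
def quotCard (N Λ : Submodule (OH p H) C) : ℕ :=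
  Nat.card (Λ ⧸ N.comap Λ.subtype)

/-- A (full) `O_H`-lattice in `C`: finitely generated and spanning `C` over `H`. -/
def IsLattice (Λ : Submodule (OH p H) C) : Prop :=
  Λ.FG ∧ Submodule.span H (Λ : Set C) = ⊤

/-- A vertex lattice: a full lattice with `ϖΛ ⊆ Λ♯ ⊆ Λ`. -/
def IsVertexLattice (φ : HermForm H C conj) (ϖ : H) (Λ : Submodule (OH p H) C) : Prop :=
  IsLattice Λ ∧ scale ϖ Λ ≤ φ.dual Λ ∧ φ.dual Λ ≤ Λ

/-- `Λ ∈ Vert(L)`: a vertex lattice with `L ⊆ Λ♯`. -/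
def InVert (φ : HermForm H C conj) (ϖ : H) (L Λ : Submodule (OH p H) C) : Prop :=
  IsVertexLattice φ ϖ Λ ∧ L ≤ φ.dual Λ

/-- `M` is `a`-modular (e.g. `a = ϖ^i`): `(x, M) = a·O_H` for every maximal `x ∈ M`. -/
def IsPiModular (φ : HermForm H C conj) (ϖ a : H) (M : Submodule (OH p H) C) : Prop :=
  ∀ x ∈ M, x ∉ scale ϖ M →
    (fun y => φ.form x y) '' (M : Set C) = (fun c => a * c) '' ((OH p H : Set H))

/-- `N` is split: an orthogonal direct sum of hyperbolic planes `H(i)`. -/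
def IsSplitLat (φ : HermForm H C conj) (ϖ : H) (N : Submodule (OH p H) C) : Prop :=
  ∃ (s : ℕ) (e f : Fin s → C) (d : Fin s → ℕ),
    N = Submodule.span (OH p H) (Set.range e ∪ Set.range f) ∧
    (∀ j, φ.form (e j) (e j) = 0 ∧ φ.form (f j) (f j) = 0 ∧
      φ.form (e j) (f j) = ϖ ^ d j) ∧
    ∀ j j', j ≠ j' → φ.form (e j) (e j') = 0 ∧ φ.form (e j) (f j') = 0 ∧
      φ.form (f j) (e j') = 0 ∧ φ.form (f j) (f j') = 0

/-- The `O_H`-rank of a sublattice of `C` (the dimension of the subspace it spans). -/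
def rk (N : Submodule (OH p H) C) : ℕ :=
  Module.finrank H (Submodule.span H (N : Set C))

/-- A Jordan splitting `L = ⊕_{0 ≤ λ ≤ k} L_λ` with `L_λ` being `ϖ^λ`-modular (or zero). -/
structure JordanSplitting (φ : HermForm H C conj) (ϖ : H) (L : Submodule (OH p H) C)
    (k : ℕ) (Lc : ℕ → Submodule (OH p H) C) : Prop where
  sup_eq : L = ⨆ i ∈ Finset.range (k + 1), Lc i
  bot_of_gt : ∀ i, k < i → Lc i = ⊥
  disj : ∀ i ∈ Finset.range (k + 1),
    Disjoint (Lc i) (⨆ j ∈ (Finset.range (k + 1)).erase i, Lc j)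
  orthog : ∀ i j, i ≠ j → ∀ x ∈ Lc i, ∀ y ∈ Lc j, φ.form x y = 0
  modular : ∀ i ∈ Finset.range (k + 1), Lc i ≠ ⊥ → IsPiModular φ ϖ (ϖ ^ i) (Lc i)

/-- `L_{≥ t} = ⊕_{λ ≥ t} L_λ`. -/
def Lge (Lc : ℕ → Submodule (OH p H) C) (k t : ℕ) : Submodule (OH p H) C :=
  ⨆ i ∈ Finset.Icc t k, Lc i

/-- `m(L) = rank_{O_H} L_{≥1}`. -/
def mOf (Lc : ℕ → Submodule (OH p H) C) (k : ℕ) : ℕ :=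
  ∑ i ∈ Finset.Icc 1 k, rk (Lc i)

/-- The invariant `t(L)` from Theorem A. -/
def tOf (φ : HermForm H C conj) (ϖ : H) (Lc : ℕ → Submodule (OH p H) C) (k : ℕ) : ℕ :=
  if Odd (mOf Lc k) then mOf Lc k - 1
  else if IsSplitLat φ ϖ (Lge Lc k 1) then mOf Lc k
  else mOf Lc k - 2

/-- `n_odd = Σ_{λ ≥ 3, λ odd} rank L_λ`. -/
def nOdd (Lc : ℕ → Submodule (OH p H) C) (k : ℕ) : ℕ :=
  ∑ i ∈ (Finset.Icc 3 k).filter (fun i => Odd i), rk (Lc i)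

/-- `n_even = Σ_{λ ≥ 2, λ even} rank L_λ`. -/
def nEven (Lc : ℕ → Submodule (OH p H) C) (k : ℕ) : ℕ :=
  ∑ i ∈ (Finset.Icc 2 k).filter (fun i => Even i), rk (Lc i)

end Ramified

namespace Ramified

section Arithmetic

variable {p : ℕ} [Fact (Nat.Prime p)]

theorem padic_norm_sub_le_max (x y : ℚ_[p]) : ‖x - y‖ ≤ max ‖x‖ ‖y‖ := by
  simpa [sub_eq_add_neg] using Padic.nonarchimedean x (-y)

theorem norm_le_one_of_norm_sq_sub_mul_sq_le_one (v : ℤ_[p]ˣ) (q r : ℚ_[p])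
    (h : ‖q ^ 2 - r ^ 2 * ((v : ℤ_[p]) * p)‖ ≤ 1) : ‖q‖ ≤ 1 ∧ ‖r‖ ≤ 1 := by
  have hp1 : (1 : ℝ) < p := by exact_mod_cast (Fact.out : Nat.Prime p).one_lt
  have hv : ‖((v : ℤ_[p]) : ℚ_[p])‖ = 1 := PadicInt.norm_units v
  have hn : ‖r ^ 2 * (((v : ℤ_[p]) : ℚ_[p]) * p)‖ = ‖r‖ ^ 2 * (p : ℝ)⁻¹ := by
    rw [norm_mul, norm_mul, hv, norm_pow, Padic.norm_p, one_mul]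
  have key : ‖q‖ ^ 2 ≤ 1 ∧ ‖r‖ ^ 2 * (p : ℝ)⁻¹ ≤ 1 := by
    by_cases hne : ‖q ^ 2‖ = ‖-(r ^ 2 * (((v : ℤ_[p]) : ℚ_[p]) * p))‖
    · rw [norm_neg, hn, norm_pow] at hne
      by_cases hr : r = 0
      · subst hr
        simp only [norm_zero] at hne ⊢
        norm_num at hne
        simp [hne]
      · by_cases hq : q = 0
        · subst hq
          have : 0 < ‖r‖ ^ 2 * (p : ℝ)⁻¹ := by positivity
          norm_num at hne
          exfalso
          rcases hne with h1 | h1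
          · exact hr h1
          · rw [h1] at hp1; norm_num at hp1
        · exfalso
          rw [Padic.norm_eq_zpow_neg_valuation hq, Padic.norm_eq_zpow_neg_valuation hr,
            ← zpow_natCast, ← zpow_natCast, ← zpow_mul, ← zpow_mul, ← zpow_neg_one,
            ← zpow_add₀ (by positivity)] at hne
          have := zpow_right_injective₀ (by positivity) hp1.ne' hne
          push_cast at this
          omega
    · have := Padic.add_eq_max_of_ne hne
      rw [← sub_eq_add_neg] at this
      rw [this, max_le_iff, norm_neg, hn, norm_pow] at h
      exact h
  refine ⟨by nlinarith [key.1, norm_nonneg q], ?_⟩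
  have h2 : ‖r‖ ^ 2 ≤ p := by
    have := key.2
    rwa [mul_inv_le_iff₀ (by positivity), one_mul] at this
  by_contra! hr
  have hr0 : r ≠ 0 := by
    rintro rfl
    norm_num at hr
  rw [Padic.norm_eq_zpow_neg_valuation hr0] at hr h2
  rw [← zpow_natCast, ← zpow_mul] at h2
  have h3 : (0 : ℤ) < -r.valuation := (one_lt_zpow_iff_right₀ hp1).1 hr
  have h4 : -r.valuation * ((2 : ℕ) : ℤ) ≤ 1 :=
    (zpow_le_zpow_iff_right₀ hp1).1 (by simpa using h2)
  push_cast at h4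
  omega

theorem norm_two_eq_one (hp : p ≠ 2) : ‖(2 : ℤ_[p])‖ = 1 := by
  have h : ‖((2 : ℕ) : ℤ_[p])‖ = 1 := by
    rw [PadicInt.norm_natCast_eq_one_iff]
    exact (Nat.coprime_primes Fact.out Nat.prime_two).2 hp
  exact_mod_cast h

open Polynomial in
/-- A unit of `ℤ_p`, `p` odd, is minus a square if it is so modulo `p`. -/
theorem exists_sq_eq_neg (hp : p ≠ 2) (u : ℤ_[p]ˣ) (q : ℤ_[p]) (hq : ‖q ^ 2 + u‖ < 1) :
    ∃ t : ℤ_[p], t ^ 2 = -u := by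
  have hq1 : ‖q‖ = 1 := by
    have hqu : ‖q ^ 2‖ = ‖-(u : ℤ_[p])‖ := by
      by_contra hne
      have := PadicInt.norm_add_eq_max_of_ne (p := p) (q := q ^ 2) (r := (u : ℤ_[p]))
        (by rwa [norm_neg] at hne)
      rw [this, PadicInt.norm_units] at hq
      exact absurd hq (not_lt.2 (le_max_right _ _))
    rw [norm_neg, PadicInt.norm_units, norm_pow] at hqu
    exact (pow_eq_one_iff_of_nonneg (norm_nonneg q) two_ne_zero).1 hqu
  obtain ⟨t, ht, -⟩ := hensels_lemma (F := (X ^ 2 + C (u : ℤ_[p]) : ℤ_[p][X])) (a := q) (by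
    simpa [norm_two_eq_one hp, hq1, derivative_X_pow, one_add_one_eq_two] using hq)
  refine ⟨t, ?_⟩
  simp at ht
  linear_combination ht

end Arithmetic

section Integers

variable {p : ℕ} [Fact (Nat.Prime p)] {H : Type} [Field H] [Algebra ℚ_[p] H]

theorem mem_OH_iff (x : H) :
    x ∈ OH p H ↔ ((algebraMap ℚ_[p] H).comp PadicInt.Coe.ringHom).IsIntegralElem x :=
  Iff.rfl

theorem algebraMap_mem_OH_iff (q : ℚ_[p]) : algebraMap ℚ_[p] H q ∈ OH p H ↔ ‖q‖ ≤ 1 := by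
  rw [mem_OH_iff]
  constructor
  · rintro ⟨P, hP, h⟩
    rw [← Polynomial.hom_eval₂, map_eq_zero] at h
    have hint : IsIntegral ℤ_[p] q := ⟨P, hP, h⟩
    obtain ⟨z, rfl⟩ := IsIntegrallyClosed.isIntegral_iff.1 hint
    exact z.2
  · intro h
    exact RingHom.isIntegralElem_map (f := (algebraMap ℚ_[p] H).comp PadicInt.Coe.ringHom)
      (x := (⟨q, h⟩ : ℤ_[p]))

variable {conj : H ≃+* H} {ϖ : H}


namespace IsRamifiedQuadratic

theorem conj_mem_OH (hram : IsRamifiedQuadratic p H conj ϖ) {x : H} (hx : x ∈ OH p H) :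
    conj x ∈ OH p H := by
  obtain ⟨P, hP, h⟩ := (mem_OH_iff x).1 hx
  refine (mem_OH_iff _).2 ⟨P, hP, ?_⟩
  have h1 := congrArg (conj : H →+* H) h
  rw [Polynomial.hom_eval₂, map_zero] at h1
  have hcomp : (conj : H →+* H).comp ((algebraMap ℚ_[p] H).comp PadicInt.Coe.ringHom) =
      (algebraMap ℚ_[p] H).comp PadicInt.Coe.ringHom :=
    RingHom.ext fun z => hram.conj_fix z
  rwa [hcomp] at h1

theorem unif_mem_OH (hram : IsRamifiedQuadratic p H conj ϖ) : ϖ ∈ OH p H := by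
  obtain ⟨v, hv⟩ := hram.unif_sq
  refine (mem_OH_iff _).2 ⟨Polynomial.X ^ 2 - Polynomial.C ((v : ℤ_[p]) * p),
    Polynomial.monic_X_pow_sub_C _ two_ne_zero, ?_⟩
  have hcoe : PadicInt.Coe.ringHom (v : ℤ_[p]) = ((v : ℤ_[p]) : ℚ_[p]) := rfl
  simp [pow_two, hv, hcoe]

theorem unif_ne_zero (hram : IsRamifiedQuadratic p H conj ϖ) : ϖ ≠ 0 := by
  obtain ⟨v, hv⟩ := hram.unif_sq
  rintro rfl
  have h1 : algebraMap ℚ_[p] H (((v : ℤ_[p]) : ℚ_[p]) * p) = 0 := by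
    rw [map_mul, map_natCast, ← hv, mul_zero]
  rw [map_eq_zero, mul_eq_zero] at h1
  rcases h1 with h1 | h1
  · exact v.ne_zero (PadicInt.coe_eq_zero.1 h1)
  · exact (Fact.out : Nat.Prime p).ne_zero (by exact_mod_cast h1)

theorem exists_eq_add_mul_unif (hram : IsRamifiedQuadratic p H conj ϖ) (x : H) :
    ∃ q r : ℚ_[p], x = algebraMap ℚ_[p] H q + algebraMap ℚ_[p] H r * ϖ := by
  have hli : LinearIndependent ℚ_[p] ![(1 : H), ϖ] := by
    rw [LinearIndependent.pair_iff]
    intro s t h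
    rw [Algebra.smul_def, Algebra.smul_def, mul_one] at h
    have h1 := congrArg conj h
    rw [map_add, map_mul, hram.conj_fix, hram.conj_fix, hram.conj_unif, map_zero] at h1
    have hs : algebraMap ℚ_[p] H (2 * s) = 0 := by
      rw [map_mul, map_ofNat]
      linear_combination h + h1
    have hs0 : s = 0 := by simpa using hs
    subst hs0
    simpa [hram.unif_ne_zero] using h
  have : FiniteDimensional ℚ_[p] H := Module.finite_of_finrank_eq_succ hram.dim_two
  have htop := hli.span_eq_top_of_card_eq_finrank' (by simp [hram.dim_two])
  have hx : x ∈ Submodule.span ℚ_[p] (Set.range ![(1 : H), ϖ]) := htop ▸ Submodule.mem_top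
  rw [Matrix.range_cons, Matrix.range_cons, Matrix.range_empty, Set.union_empty,
    Set.singleton_union, Submodule.mem_span_pair] at hx
  obtain ⟨q, r, rfl⟩ := hx
  exact ⟨q, r, by rw [Algebra.smul_def, Algebra.smul_def, mul_one]⟩

/-- Norms lie in `ℚ_p`; an element whose norm is integral is itself integral; and an element
of integral norm has norm congruent to a square modulo `p`. -/
theorem exists_norm_eq (hram : IsRamifiedQuadratic p H conj ϖ) (x : H) :
    ∃ n : ℚ_[p], x * conj x = algebraMap ℚ_[p] H n ∧
      (‖n‖ ≤ 1 → x ∈ OH p H ∧ ∃ q : ℤ_[p], ‖n - (q : ℚ_[p]) ^ 2‖ < 1) := by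
  obtain ⟨v, hv⟩ := hram.unif_sq
  obtain ⟨q, r, rfl⟩ := hram.exists_eq_add_mul_unif x
  have hnorm : (algebraMap ℚ_[p] H q + algebraMap ℚ_[p] H r * ϖ) *
      conj (algebraMap ℚ_[p] H q + algebraMap ℚ_[p] H r * ϖ) =
      algebraMap ℚ_[p] H (q ^ 2 - r ^ 2 * ((v : ℤ_[p]) * p)) := by
    simp only [map_add, map_mul, map_sub, map_pow, map_natCast, hram.conj_fix, hram.conj_unif]
    linear_combination -(algebraMap ℚ_[p] H r) ^ 2 * hv
  refine ⟨_, hnorm, fun h => ?_⟩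
  obtain ⟨hq, hr⟩ := norm_le_one_of_norm_sq_sub_mul_sq_le_one v q r h
  refine ⟨add_mem ((algebraMap_mem_OH_iff q).2 hq)
    (mul_mem ((algebraMap_mem_OH_iff r).2 hr) hram.unif_mem_OH), ⟨q, hq⟩, ?_⟩
  have hv1 : ‖((v : ℤ_[p]) : ℚ_[p])‖ = 1 := PadicInt.norm_units v
  have hlt : ‖r‖ ^ 2 * (p : ℝ)⁻¹ < 1 :=
    mul_lt_one_of_nonneg_of_lt_one_right (pow_le_one₀ (norm_nonneg _) hr) (by positivity)
      (inv_lt_one_of_one_lt₀ (by exact_mod_cast (Fact.out : Nat.Prime p).one_lt))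
  simpa [hv1] using hlt

/-- If `-u` is not a norm, the binary form `⟨1, u⟩` represents integers only at integral vectors. -/
theorem mem_OH_of_norm_add_mem (hram : IsRamifiedQuadratic p H conj ϖ) (hp : p ≠ 2)
    (u : ℤ_[p]ˣ)
    (hu : ∀ y : H, y ≠ 0 → y * conj y ≠ -(algebraMap ℚ_[p] H ((u : ℤ_[p]) : ℚ_[p])))
    {α β : H}
    (h : α * conj α + algebraMap ℚ_[p] H ((u : ℤ_[p]) : ℚ_[p]) * (β * conj β) ∈ OH p H) :
    α ∈ OH p H ∧ β ∈ OH p H := by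
  obtain ⟨m, hm, hmi⟩ := hram.exists_norm_eq α
  obtain ⟨n, hn, hni⟩ := hram.exists_norm_eq β
  have hu1 : ‖((u : ℤ_[p]) : ℚ_[p])‖ = 1 := PadicInt.norm_units u
  rw [hm, hn, ← map_mul, ← map_add, algebraMap_mem_OH_iff] at h
  suffices hb : ‖n‖ ≤ 1 by
    refine ⟨(hmi ?_).1, (hni hb).1⟩
    have hsub : m = (m + (u : ℤ_[p]) * n) - (u : ℤ_[p]) * n := by ring
    rw [hsub]
    refine (padic_norm_sub_le_max _ _).trans (max_le h ?_)
    rwa [norm_mul, hu1, one_mul]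
  by_contra! hb
  have hnz : n ≠ 0 := by
    rintro rfl
    norm_num at hb
  obtain ⟨k, hk, hki⟩ := hram.exists_norm_eq (α / β)
  have hkm : k = m / n := by
    apply (algebraMap ℚ_[p] H).injective
    rw [← hk, map_div₀, map_div₀, ← hm, ← hn, div_mul_div_comm]
  have hku : ‖k + (u : ℤ_[p])‖ < 1 := by
    have : k + (u : ℤ_[p]) = (m + (u : ℤ_[p]) * n) / n := by
      rw [hkm]
      field_simp
    rw [this, norm_div, div_lt_one (by linarith)]
    linarith
  have hk1 : ‖k‖ ≤ 1 := by
    have hsub : k = (k + (u : ℤ_[p])) - (u : ℤ_[p]) := by ring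
    rw [hsub]
    exact (padic_norm_sub_le_max _ _).trans (max_le hku.le hu1.le)
  obtain ⟨-, q, hq⟩ := hki hk1
  have hqu : ‖q ^ 2 + (u : ℤ_[p])‖ < 1 := by
    rw [PadicInt.norm_def]
    push_cast
    have hsub : (q : ℚ_[p]) ^ 2 + (u : ℤ_[p]) = (k + (u : ℤ_[p])) - (k - (q : ℚ_[p]) ^ 2) := by
      ring
    rw [hsub]
    exact (padic_norm_sub_le_max _ _).trans_lt (max_lt hku hq)
  obtain ⟨t, ht⟩ := exists_sq_eq_neg hp u q hqu
  refine hu (algebraMap ℚ_[p] H t) ?_ ?_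
  · rw [Ne, map_eq_zero, PadicInt.coe_eq_zero]
    rintro rfl
    exact u.ne_zero (by simpa using ht.symm)
  · rw [hram.conj_fix, ← map_mul, ← map_neg, ← pow_two]
    exact_mod_cast congrArg (fun z : ℤ_[p] => algebraMap ℚ_[p] H z) ht

end IsRamifiedQuadratic
end Integers

section Lattices

variable {p : ℕ} [Fact (Nat.Prime p)] {H : Type} [Field H] [Algebra ℚ_[p] H]
  {C : Type} [AddCommGroup C] [Module H C] {conj : H ≃+* H}

namespace HermForm

theorem form_add_right (φ : HermForm H C conj) (x y z : C) :
    φ.form x (y + z) = φ.form x y + φ.form x z := by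
  rw [φ.form_conj, φ.form_add, map_add, ← φ.form_conj, ← φ.form_conj]

theorem form_smul_right (φ : HermForm H C conj) (a : H) (x y : C) :
    φ.form x (a • y) = conj a * φ.form x y := by
  rw [φ.form_conj, φ.form_smul, map_mul, ← φ.form_conj]

theorem form_pair (φ : HermForm H C conj) {f1 f2 : C} {d : H} (h11 : φ.form f1 f1 = 1)
    (h22 : φ.form f2 f2 = d) (h12 : φ.form f1 f2 = 0) (α β γ δ : H) :
    φ.form (α • f1 + β • f2) (γ • f1 + δ • f2) = α * conj γ + d * (β * conj δ) := by
  have h21 : φ.form f2 f1 = 0 := by rw [φ.form_conj, h12, map_zero]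
  simp only [φ.form_add, φ.form_smul, form_add_right, form_smul_right, h11, h22, h12, h21]
  ring

end HermForm

theorem mem_span_OH_pair {f1 f2 x : C} : x ∈ Submodule.span (OH p H) ({f1, f2} : Set C) ↔
    ∃ α ∈ OH p H, ∃ β ∈ OH p H, α • f1 + β • f2 = x := by
  rw [Submodule.mem_span_pair]
  constructor
  · rintro ⟨α, β, h⟩
    exact ⟨α, α.2, β, β.2, h⟩
  · rintro ⟨α, hα, β, hβ, h⟩
    exact ⟨⟨α, hα⟩, ⟨β, hβ⟩, h⟩

theorem isLattice_span_pair {f1 f2 : C} (hspan : Submodule.span H ({f1, f2} : Set C) = ⊤) :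
    IsLattice (Submodule.span (OH p H) ({f1, f2} : Set C)) := by
  refine ⟨Submodule.fg_span (Set.toFinite _), top_le_iff.1 ?_⟩
  rw [← hspan]
  exact Submodule.span_mono Submodule.subset_span

theorem dual_span_pair {ϖ : H} (hram : IsRamifiedQuadratic p H conj ϖ) (φ : HermForm H C conj)
    {f1 f2 : C} (hspan : Submodule.span H ({f1, f2} : Set C) = ⊤) (u : ℤ_[p]ˣ)
    (h11 : φ.form f1 f1 = 1) (h22 : φ.form f2 f2 = algebraMap ℚ_[p] H ((u : ℤ_[p]) : ℚ_[p]))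
    (h12 : φ.form f1 f2 = 0) :
    φ.dual (Submodule.span (OH p H) ({f1, f2} : Set C)) =
      Submodule.span (OH p H) ({f1, f2} : Set C) := by
  have hint : ∀ z : ℤ_[p], algebraMap ℚ_[p] H z ∈ OH p H :=
    fun z => (algebraMap_mem_OH_iff _).2 z.2
  ext x
  constructor
  · intro hx
    obtain ⟨α, β, rfl⟩ := Submodule.mem_span_pair.1 (hspan ▸ Submodule.mem_top : x ∈ _)
    refine mem_span_OH_pair.2 ⟨α, ?_, β, ?_, rfl⟩
    · have h1 := hx ((1 : H) • f1 + (0 : H) • f2)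
        (mem_span_OH_pair.2 ⟨1, one_mem _, 0, zero_mem _, rfl⟩)
      rw [φ.form_pair h11 h22 h12] at h1
      simpa using h1
    · have h2 := hx ((0 : H) • f1 + (1 : H) • f2)
        (mem_span_OH_pair.2 ⟨0, zero_mem _, 1, one_mem _, rfl⟩)
      rw [φ.form_pair h11 h22 h12, map_zero, map_one, mul_zero, zero_add, mul_one] at h2
      have h3 := mul_mem (hint ((u⁻¹ : ℤ_[p]ˣ) : ℤ_[p])) h2
      rwa [← mul_assoc, ← map_mul, ← PadicInt.coe_mul, Units.inv_mul, PadicInt.coe_one, map_one,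
        one_mul] at h3
  · intro hx y hy
    obtain ⟨α, hα, β, hβ, rfl⟩ := mem_span_OH_pair.1 hx
    obtain ⟨γ, hγ, δ, hδ, rfl⟩ := mem_span_OH_pair.1 hy
    rw [φ.form_pair h11 h22 h12]
    exact add_mem (mul_mem hα (hram.conj_mem_OH hγ))
      (mul_mem (hint _) (mul_mem hβ (hram.conj_mem_OH hδ)))

theorem form_unif_zpow_neg {ϖ : H} (hram : IsRamifiedQuadratic p H conj ϖ)
    (φ : HermForm H C conj) {e : C} {d : H} {a : ℕ}
    (h : φ.form e e = d * (-(ϖ * ϖ)) ^ a) :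
    φ.form (ϖ ^ (-(a : ℤ)) • e) (ϖ ^ (-(a : ℤ)) • e) = d := by
  have h0 := hram.unif_ne_zero
  have hne : (-(ϖ * ϖ)) ^ a ≠ 0 := pow_ne_zero _ (neg_ne_zero.2 (mul_ne_zero h0 h0))
  rw [φ.form_smul, φ.form_smul_right, h, map_zpow₀, hram.conj_unif, ← mul_assoc, ← mul_zpow,
    mul_neg, zpow_neg, zpow_natCast, mul_left_comm, inv_mul_cancel₀ hne, mul_one]

end Lattices

/-- Let `a, b ≥ 1`, `u ∈ ℤ_p^×` with `-u` not a norm from `H^×`, and let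
`L = O_H e₁ ⊕ O_H e₂` with `(e₁,e₁) = (-π₀)^a`, `(e₂,e₂) = u(-π₀)^b`, `(e₁,e₂) = 0`
(where `π₀ = ϖ²`). Then `Λ = O_H ϖ^{-a} e₁ ⊕ O_H ϖ^{-b} e₂` is the unique self-dual
`O_H`-lattice in `L ⊗_{O_H} H` containing `L`. -/
theorem statement_12 (p : ℕ) [Fact (Nat.Prime p)] (hp : p ≠ 2)
    (H : Type) [Field H] [Algebra ℚ_[p] H] (conj : H ≃+* H) (ϖ : H)
    (hram : IsRamifiedQuadratic p H conj ϖ)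
    (C : Type) [AddCommGroup C] [Module H C]
    (φ : HermForm H C conj)
    (hnd : ∀ x : C, (∀ y : C, φ.form x y = 0) → x = 0)
    (a b : ℕ) (ha : 1 ≤ a) (hb : 1 ≤ b)
    (u : ℤ_[p]ˣ)
    (hu : ∀ y : H, y ≠ 0 →
      y * conj y ≠ -(algebraMap ℚ_[p] H ((u : ℤ_[p]) : ℚ_[p])))
    (e1 e2 : C)
    (hspan : Submodule.span H ({e1, e2} : Set C) = ⊤)
    (h11 : φ.form e1 e1 = (-(ϖ * ϖ)) ^ a)
    (h22 : φ.form e2 e2 = algebraMap ℚ_[p] H ((u : ℤ_[p]) : ℚ_[p]) * (-(ϖ * ϖ)) ^ b)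
    (h12 : φ.form e1 e2 = 0) :
    IsLattice (Submodule.span (OH p H)
        ({ϖ ^ (-(a : ℤ)) • e1, ϖ ^ (-(b : ℤ)) • e2} : Set C)) ∧
    φ.dual (Submodule.span (OH p H)
        ({ϖ ^ (-(a : ℤ)) • e1, ϖ ^ (-(b : ℤ)) • e2} : Set C))
      = Submodule.span (OH p H) ({ϖ ^ (-(a : ℤ)) • e1, ϖ ^ (-(b : ℤ)) • e2} : Set C) ∧
    Submodule.span (OH p H) ({e1, e2} : Set C)
      ≤ Submodule.span (OH p H) ({ϖ ^ (-(a : ℤ)) • e1, ϖ ^ (-(b : ℤ)) • e2} : Set C) ∧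
    (∀ Λ' : Submodule (OH p H) C, IsLattice Λ' → φ.dual Λ' = Λ' →
      Submodule.span (OH p H) ({e1, e2} : Set C) ≤ Λ' →
      Λ' = Submodule.span (OH p H)
        ({ϖ ^ (-(a : ℤ)) • e1, ϖ ^ (-(b : ℤ)) • e2} : Set C)) := by
  have h0 := hram.unif_ne_zero
  set f1 := ϖ ^ (-(a : ℤ)) • e1 with hf1
  set f2 := ϖ ^ (-(b : ℤ)) • e2 with hf2
  have g11 : φ.form f1 f1 = 1 := form_unif_zpow_neg hram φ (by rw [h11, one_mul])
  have g22 : φ.form f2 f2 = algebraMap ℚ_[p] H ((u : ℤ_[p]) : ℚ_[p]) :=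
    form_unif_zpow_neg hram φ h22
  have g12 : φ.form f1 f2 = 0 := by
    rw [hf1, hf2, φ.form_smul, φ.form_smul_right, h12, mul_zero, mul_zero]
  have he1 : ϖ ^ a • f1 = e1 := by
    rw [hf1, zpow_neg, zpow_natCast, smul_inv_smul₀ (pow_ne_zero _ h0)]
  have he2 : ϖ ^ b • f2 = e2 := by
    rw [hf2, zpow_neg, zpow_natCast, smul_inv_smul₀ (pow_ne_zero _ h0)]
  have gspan : Submodule.span H ({f1, f2} : Set C) = ⊤ := by
    rw [← top_le_iff, ← hspan, Submodule.span_le, Set.pair_subset_iff, ← he1, ← he2]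
    exact ⟨Submodule.smul_mem _ _ (Submodule.subset_span (by simp)),
      Submodule.smul_mem _ _ (Submodule.subset_span (by simp))⟩
  have gdual := dual_span_pair hram φ gspan u g11 g22 g12
  refine ⟨isLattice_span_pair gspan, gdual, ?_, fun Λ' _ hΛ _ => ?_⟩
  · rw [Submodule.span_le, Set.pair_subset_iff]
    exact ⟨mem_span_OH_pair.2
        ⟨ϖ ^ a, pow_mem hram.unif_mem_OH a, 0, zero_mem _, by rw [he1, zero_smul, add_zero]⟩,
      mem_span_OH_pair.2
        ⟨0, zero_mem _, ϖ ^ b, pow_mem hram.unif_mem_OH b, by rw [he2, zero_smul, zero_add]⟩⟩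
  · have hle : Λ' ≤ Submodule.span (OH p H) ({f1, f2} : Set C) := by
      intro x hx
      have hxx : φ.form x x ∈ OH p H := (hΛ.symm ▸ hx : x ∈ φ.dual Λ') x hx
      obtain ⟨α, β, rfl⟩ := Submodule.mem_span_pair.1 (gspan ▸ Submodule.mem_top : x ∈ _)
      rw [φ.form_pair g11 g22 g12] at hxx
      obtain ⟨hα, hβ⟩ := hram.mem_OH_of_norm_add_mem hp u hu hxx
      exact mem_span_OH_pair.2 ⟨α, hα, β, hβ, rfl⟩
    refine le_antisymm hle ?_
    rw [← hΛ, ← gdual]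
    exact fun x hx y hy => hx y (hle (hΛ ▸ hy))

end Ramified
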